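/- arXiv:0707.0218 — 3 statements merged into one kernel-verified Lean document; each statement's English description precedes it below -/
import Mathlib

section
/- Let v : B → ℝ be a function on the unit cube B such that all mixed partial derivatives D^α v with α ∈ Zⁿ = {0,1}ⁿ exist and are continuous on B. Then for any ε > 0 there exists a polynomial p in n variables such that max over α ∈ Zⁿ of sup_{x ∈ B} |D^α p(x) − D^α v(x)| ≤ ε. In particular, polynomials can approximate such v arbitrarily well in the Sobolev norm W^{1,∞}(B). -/
/-- The unit cube `B = {x ∈ ℝⁿ : ‖x‖_∞ ≤ 1}`. -/
def cubeB (n : ℕ) : Set (Fin n → ℝ) := {x | ∀ i, |x i| ≤ 1}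

/-- The partial derivative `∂f/∂x_i`, as the derivative of the one-variable slice. -/
noncomputable def pd (n : ℕ) (i : Fin n) (f : (Fin n → ℝ) → ℝ) : (Fin n → ℝ) → ℝ :=
  fun x => deriv (fun t : ℝ => f (Function.update x i t)) (x i)

/-- The mixed partial derivative `D^α f = ∂^α f / ∂x^α` for a multi-index `α ∈ ℕⁿ`. -/
noncomputable def Dmix (n : ℕ) (α : Fin n → ℕ) (f : (Fin n → ℝ) → ℝ) :
    (Fin n → ℝ) → ℝ :=
  (List.finRange n).foldr (fun i g => (pd n i)^[α i] g) f

/-- `Zⁿ = {α ∈ ℕⁿ : α_i ∈ {0,1}}`. -/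
def Zn (n : ℕ) : Finset (Fin n → ℕ) := Fintype.piFinset fun _ => ({0, 1} : Finset ℕ)

/-- The mixed partial derivative of a polynomial along the directions in the list `l`, with
multiplicities given by `α`. -/
noncomputable def polyDeriv {n : ℕ} (l : List (Fin n)) (α : Fin n → ℕ)
    (p : MvPolynomial (Fin n) ℝ) : MvPolynomial (Fin n) ℝ :=
  l.foldr (fun i g => (MvPolynomial.pderiv i)^[α i] g) p

theorem polyDeriv_cons {n : ℕ} (i : Fin n) (l : List (Fin n)) (α : Fin n → ℕ)
    (p : MvPolynomial (Fin n) ℝ) :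
    polyDeriv (i :: l) α p = (MvPolynomial.pderiv i)^[α i] (polyDeriv l α p) := rfl

theorem polyDeriv_add {n : ℕ} (l : List (Fin n)) (α : Fin n → ℕ)
    (p q : MvPolynomial (Fin n) ℝ) :
    polyDeriv l α (p + q) = polyDeriv l α p + polyDeriv l α q := by
  induction l with
  | nil => rfl
  | cons i l ih => simp only [polyDeriv_cons, ih, iterate_map_add]

theorem pderiv_comm {n : ℕ} (i j : Fin n) (p : MvPolynomial (Fin n) ℝ) :
    MvPolynomial.pderiv i (MvPolynomial.pderiv j p) =
      MvPolynomial.pderiv j (MvPolynomial.pderiv i p) := by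
  have h : ⁅MvPolynomial.pderiv (R := ℝ) i, MvPolynomial.pderiv (R := ℝ) j⁆ = 0 := by
    refine MvPolynomial.derivation_ext fun k => ?_
    simp [Derivation.commutator_apply, MvPolynomial.pderiv_X, Pi.single_apply, apply_ite]
  have := congrArg (fun D => D p) h
  simpa [Derivation.commutator_apply, sub_eq_zero] using this

theorem pderiv_polyDeriv {n : ℕ} (i : Fin n) (l : List (Fin n)) (α : Fin n → ℕ)
    (p : MvPolynomial (Fin n) ℝ) :
    MvPolynomial.pderiv i (polyDeriv l α p) = polyDeriv l α (MvPolynomial.pderiv i p) := by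
  induction l with
  | nil => rfl
  | cons j l ih =>
    rw [polyDeriv_cons, polyDeriv_cons, ← ih]
    exact Function.Commute.iterate_right (f := MvPolynomial.pderiv i) (pderiv_comm i j) (α j) _

theorem polyDeriv_X_mul {n : ℕ} {i : Fin n} {l : List (Fin n)} (hi : i ∉ l) (α : Fin n → ℕ)
    (p : MvPolynomial (Fin n) ℝ) :
    polyDeriv l α (MvPolynomial.X i * p) = MvPolynomial.X i * polyDeriv l α p := by
  induction l with
  | nil => rfl
  | cons j l ih =>
    simp only [List.mem_cons, not_or] at hi
    rw [polyDeriv_cons, polyDeriv_cons, ih hi.2]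
    refine Function.Commute.iterate_left (g := fun q => MvPolynomial.X i * q) (fun q => ?_) (α j) _
    simp [MvPolynomial.pderiv_X_of_ne hi.1]

theorem polyDeriv_update {n : ℕ} {i : Fin n} {l : List (Fin n)} (hi : i ∉ l) (α : Fin n → ℕ)
    (k : ℕ) (p : MvPolynomial (Fin n) ℝ) :
    polyDeriv l (Function.update α i k) p = polyDeriv l α p := by
  induction l with
  | nil => rfl
  | cons j l ih =>
    simp only [List.mem_cons, not_or] at hi
    rw [polyDeriv_cons, polyDeriv_cons, ih hi.2, Function.update_of_ne (Ne.symm hi.1)]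

theorem exists_pderiv_X_mul_eq {n : ℕ} (i : Fin n) (p : MvPolynomial (Fin n) ℝ) :
    ∃ g, MvPolynomial.pderiv i (MvPolynomial.X i * g) = p := by
  induction p using MvPolynomial.induction_on' with
  | monomial s a =>
    refine ⟨MvPolynomial.monomial s (a / (s i + 1)), ?_⟩
    have h : (s i : ℝ) + 1 ≠ 0 := by positivity
    rw [MvPolynomial.X, MvPolynomial.monomial_mul, MvPolynomial.pderiv_monomial]
    congr 1
    · simp
    · simp only [Finsupp.add_apply, Finsupp.single_eq_same]
      push_cast
      field_simp
      ring
  | add p q hp hq =>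
    obtain ⟨g, rfl⟩ := hp
    obtain ⟨h, rfl⟩ := hq
    exact ⟨g + h, by rw [mul_add, map_add]⟩

theorem hasDerivAt_eval_update {n : ℕ} (i : Fin n) (p : MvPolynomial (Fin n) ℝ)
    (x : Fin n → ℝ) (t : ℝ) :
    HasDerivAt (fun s : ℝ => MvPolynomial.eval (Function.update x i s) p)
      (MvPolynomial.eval (Function.update x i t) (MvPolynomial.pderiv i p)) t := by
  induction p using MvPolynomial.induction_on with
  | C a => simpa using hasDerivAt_const t a
  | add p q hp hq => simpa only [map_add] using HasDerivAt.fun_add hp hq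
  | mul_X p j hp =>
    have hX : HasDerivAt (fun s : ℝ => Function.update x i s j)
        (MvPolynomial.eval (Function.update x i t)
          (MvPolynomial.pderiv i (MvPolynomial.X j : MvPolynomial (Fin n) ℝ))) t := by
      rcases eq_or_ne j i with rfl | h
      · simpa using hasDerivAt_id' t
      · simpa [MvPolynomial.pderiv_X_of_ne h, h] using hasDerivAt_const t (x j)
    simp only [Derivation.leibniz, smul_eq_mul, map_mul, map_add, MvPolynomial.eval_X]
    refine (HasDerivAt.fun_mul hp hX).congr_deriv ?_
    ring

theorem pd_eval {n : ℕ} (i : Fin n) (p : MvPolynomial (Fin n) ℝ) :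
    pd n i (fun y => MvPolynomial.eval y p) =
      fun y => MvPolynomial.eval y (MvPolynomial.pderiv i p) := by
  funext x
  simpa [pd] using (hasDerivAt_eval_update i p x (x i)).deriv

theorem iterate_pd_eval {n : ℕ} (i : Fin n) (k : ℕ) (p : MvPolynomial (Fin n) ℝ) :
    (pd n i)^[k] (fun y => MvPolynomial.eval y p) =
      fun y => MvPolynomial.eval y ((MvPolynomial.pderiv i)^[k] p) := by
  induction k generalizing p with
  | zero => rfl
  | succ k ih => rw [Function.iterate_succ_apply, Function.iterate_succ_apply, pd_eval, ih]

theorem Dmix_eval {n : ℕ} (α : Fin n → ℕ) (p : MvPolynomial (Fin n) ℝ) :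
    Dmix n α (fun y => MvPolynomial.eval y p) =
      fun y => MvPolynomial.eval y (polyDeriv (List.finRange n) α p) := by
  unfold Dmix
  induction List.finRange n with
  | nil => rfl
  | cons i l ih => rw [List.foldr_cons, ih, iterate_pd_eval, polyDeriv_cons]

theorem isCompact_cubeB (n : ℕ) : IsCompact (cubeB n) := by
  have h : cubeB n = Set.pi Set.univ fun _ => Set.Icc (-1 : ℝ) 1 := by
    ext x
    simp only [cubeB, Set.mem_ofPred_eq, Set.mem_univ_pi, Set.mem_Icc, abs_le]
  rw [h]
  exact isCompact_univ_pi fun _ => isCompact_Icc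

theorem update_mem_cubeB {n : ℕ} {x : Fin n → ℝ} (hx : x ∈ cubeB n) (i : Fin n) {t : ℝ}
    (ht : |t| ≤ 1) : Function.update x i t ∈ cubeB n := by
  intro j
  rcases eq_or_ne j i with rfl | h
  · simpa using ht
  · simpa [h] using hx j

/-- The Weierstrass approximation theorem on compact subsets of `ℝⁿ`. -/
theorem exists_mvPolynomial_near {n : ℕ} {K : Set (Fin n → ℝ)} (hK : IsCompact K)
    {f : (Fin n → ℝ) → ℝ} (hf : ContinuousOn f K) {ε : ℝ} (hε : 0 < ε) :
    ∃ p : MvPolynomial (Fin n) ℝ, ∀ x ∈ K, |MvPolynomial.eval x p - f x| ≤ ε := by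
  have := isCompact_iff_compactSpace.mp hK
  let coord : Fin n → C(K, ℝ) := fun i => ⟨fun x => x.1 i, (continuous_apply i).comp continuous_subtype_val⟩
  let φ : MvPolynomial (Fin n) ℝ →ₐ[ℝ] C(K, ℝ) := MvPolynomial.aeval coord
  have hφ : ∀ p (x : K), φ p x = MvPolynomial.eval x.1 p := by
    intro p x
    induction p using MvPolynomial.induction_on with
    | C a => simp [φ]
    | add p q hp hq => simp [hp, hq]
    | mul_X p j hp => simp [hp, φ, coord]
  have hsep : φ.range.SeparatesPoints := by
    intro x y hxy
    obtain ⟨i, hi⟩ := Function.ne_iff.mp (Subtype.coe_ne_coe.mpr hxy)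
    exact ⟨φ (MvPolynomial.X i), ⟨_, ⟨_, rfl⟩, rfl⟩, by simpa [hφ] using hi⟩
  obtain ⟨⟨g, p, rfl⟩, hg⟩ :=
    ContinuousMap.exists_mem_subalgebra_near_continuousMap_of_separatesPoints φ.range hsep
      ⟨K.domRestrict f, hf.domRestrict⟩ ε hε
  refine ⟨p, fun x hx => ?_⟩
  have h := (ContinuousMap.norm_coe_le_norm _ (⟨x, hx⟩ : K)).trans hg.le
  simpa [hφ] using h

theorem update_mem_Zn {n : ℕ} {α : Fin n → ℕ} (hα : α ∈ Zn n) (i : Fin n) {k : ℕ}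
    (hk : k = 0 ∨ k = 1) : Function.update α i k ∈ Zn n := by
  simp only [Zn, Fintype.mem_piFinset, Finset.mem_insert, Finset.mem_singleton] at hα ⊢
  intro j
  rcases eq_or_ne j i with rfl | h
  · simpa using hk
  · simpa [h] using hα j

theorem update_add_single {n : ℕ} (α : Fin n → ℕ) {i j : Fin n} (hij : j ≠ i) (k : ℕ) :
    Function.update (α + Pi.single j 1) i k = Function.update α i k + Pi.single j 1 := by
  funext m
  rcases eq_or_ne m i with rfl | h
  · simp [Ne.symm hij]
  · simp [h]

theorem add_single_eq_update {n : ℕ} {α : Fin n → ℕ} {i : Fin n} (hi : α i = 0) :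
    α + Pi.single i 1 = Function.update α i 1 := by
  funext m
  rcases eq_or_ne m i with rfl | h
  · simp [hi]
  · simp [h]

theorem abs_sub_le_of_abs_deriv_sub_le {f g f' g' : ℝ → ℝ} {δ s : ℝ}
    (hf : ∀ t, |t| ≤ 1 → HasDerivAt f (f' t) t) (hg : ∀ t, |t| ≤ 1 → HasDerivAt g (g' t) t)
    (h0 : |f 0 - g 0| ≤ δ) (h1 : ∀ t, |t| ≤ 1 → |f' t - g' t| ≤ δ) (hs : |s| ≤ 1) :
    |f s - g s| ≤ 2 * δ := by
  have hδ : 0 ≤ δ := (abs_nonneg _).trans h0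
  have h := (convex_Icc (-1 : ℝ) 1).norm_image_sub_le_of_norm_hasDerivWithin_le
    (f := f - g) (f' := f' - g') (C := δ) (x := 0) (y := s)
    (fun t ht => ((hf t (abs_le.mpr ht)).sub (hg t (abs_le.mpr ht))).hasDerivWithinAt)
    (fun t ht => h1 t (abs_le.mpr ht)) (Set.mem_Icc.mpr (by norm_num)) (abs_le.mp hs)
  simp only [Pi.sub_apply, Real.norm_eq_abs, sub_zero] at h
  have h2 : δ * |s| ≤ δ := mul_le_of_le_one_right hδ hs
  have h3 := abs_sub_abs_le_abs_sub (f s - g s) (f 0 - g 0)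
  linarith

theorem exists_polyDeriv_near {n : ℕ} (l : List (Fin n)) (hl : l.Nodup)
    (F : (Fin n → ℕ) → (Fin n → ℝ) → ℝ)
    (hder : ∀ α ∈ Zn n, ∀ i ∈ l, α i = 0 → ∀ x ∈ cubeB n,
      HasDerivAt (fun t : ℝ => F α (Function.update x i t))
        (F (α + Pi.single i 1) x) (x i))
    (hcont : ∀ α ∈ Zn n, ContinuousOn (F α) (cubeB n)) {ε : ℝ} (hε : 0 < ε) :
    ∃ p : MvPolynomial (Fin n) ℝ, ∀ α ∈ Zn n, (∀ i ∉ l, α i = 0) → ∀ x ∈ cubeB n,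
      |MvPolynomial.eval x (polyDeriv l α p) - F α x| ≤ ε := by
  induction l generalizing F ε with
  | nil =>
    obtain ⟨p, hp⟩ := exists_mvPolynomial_near (isCompact_cubeB n)
      (hcont 0 (by simp [Zn])) hε
    refine ⟨p, fun α _ h0 x hx => ?_⟩
    obtain rfl : α = 0 := funext fun i => h0 i (by simp)
    exact hp x hx
  | cons i l ih =>
    obtain ⟨hi, hl⟩ := List.nodup_cons.mp hl
    obtain ⟨q, hq⟩ := ih hl (fun α => F (Function.update α i 1))
      (fun α hα j hj hαj x hx => by
        have hji : j ≠ i := fun h => hi (h ▸ hj)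
        rw [update_add_single α hji]
        exact hder _ (update_mem_Zn hα i (.inr rfl)) j (List.mem_cons_of_mem _ hj)
          (by simpa [hji] using hαj) x hx)
      (fun α hα => hcont _ (update_mem_Zn hα i (.inr rfl))) (half_pos hε)
    obtain ⟨r, hr⟩ := ih hl (fun α x => F (Function.update α i 0) (Function.update x i 0))
      (fun α hα j hj hαj x hx => by
        have hji : j ≠ i := fun h => hi (h ▸ hj)
        rw [update_add_single α hji]
        have h := hder _ (update_mem_Zn hα i (.inl rfl)) j (List.mem_cons_of_mem _ hj)
          (by simpa [hji] using hαj) _ (update_mem_cubeB hx i (t := 0) (by simp))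
        simpa only [Function.update_of_ne hji, Function.update_comm hji] using h)
      (fun α hα => (hcont _ (update_mem_Zn hα i (.inl rfl))).comp (by fun_prop)
        fun x hx => update_mem_cubeB hx i (by simp)) (half_pos hε)
    obtain ⟨g, hg⟩ := exists_pderiv_X_mul_eq i (q - MvPolynomial.pderiv i r)
    have hp : MvPolynomial.pderiv i (r + MvPolynomial.X i * g) = q := by
      rw [map_add, hg, add_sub_cancel]
    refine ⟨r + MvPolynomial.X i * g, fun α hα hαl x hx => ?_⟩
    have hsupp : ∀ j ∉ l, Function.update α i 0 j = 0 := by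
      intro j hj
      rcases eq_or_ne j i with rfl | h
      · simp
      · simpa [h] using hαl j (by simp [h, hj])
    have hα0 := update_mem_Zn hα i (.inl rfl : (0 : ℕ) = 0 ∨ (0 : ℕ) = 1)
    have hq' : ∀ y ∈ cubeB n, |MvPolynomial.eval y (polyDeriv l α q) -
        F (Function.update α i 1) y| ≤ ε / 2 := by
      intro y hy
      simpa [polyDeriv_update hi] using hq _ hα0 hsupp y hy
    rw [polyDeriv_cons]
    have hαi : α i = 0 ∨ α i = 1 := by simpa [Zn] using Fintype.mem_piFinset.mp hα i
    rcases hαi with hαi | hαi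
    · rw [hαi, Function.iterate_zero_apply]
      have hupd : Function.update α i 0 = α := by rw [← hαi, Function.update_eq_self]
      have h := abs_sub_le_of_abs_deriv_sub_le (s := x i) (δ := ε / 2)
        (fun t _ => hasDerivAt_eval_update i (polyDeriv l α (r + MvPolynomial.X i * g)) x t)
        (fun t ht => by
          simpa using hder α hα i (by simp) hαi _ (update_mem_cubeB hx i ht))
        (by
          have h := hr _ hα0 hsupp _ (update_mem_cubeB hx i (t := 0) (by simp))
          simpa [polyDeriv_add, polyDeriv_X_mul hi, hupd] using h)
        (fun t ht => by
          rw [pderiv_polyDeriv, hp, add_single_eq_update hαi]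
          exact hq' _ (update_mem_cubeB hx i ht))
        (hx i)
      simpa [mul_div_cancel₀] using h
    · rw [hαi, Function.iterate_one, pderiv_polyDeriv, hp]
      have h := hq' x hx
      rw [(Function.update_eq_self_iff (a := i)).mpr hαi.symm] at h
      linarith

/-- let `v : B → ℝ` be such that all mixed partial derivatives `D^α v`
with `α ∈ Zⁿ = {0,1}ⁿ` exist and are continuous on `B` (the family `{D^α v}` is
encoded by `F`, with `F 0 = v` and `F (α + eᵢ)` the partial derivative of `F α`
in the `i`-th variable on `B`).  Then for any `ε > 0` there exists a polynomial `p`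
in `n` variables with `max_{α ∈ Zⁿ} sup_{x ∈ B} |D^α p(x) − D^α v(x)| ≤ ε`,
i.e. polynomials approximate `v` arbitrarily well in the Sobolev norm `W^{1,∞}(B)`. -/
theorem poly_approx_W1inf (n : ℕ) (v : (Fin n → ℝ) → ℝ)
    (F : (Fin n → ℕ) → (Fin n → ℝ) → ℝ) (hF0 : F 0 = v)
    (hder : ∀ α ∈ Zn n, ∀ i : Fin n, α i = 0 → ∀ x ∈ cubeB n,
      HasDerivAt (fun t : ℝ => F α (Function.update x i t))
        (F (α + Pi.single i 1) x) (x i))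
    (hcont : ∀ α ∈ Zn n, ContinuousOn (F α) (cubeB n))
    (ε : ℝ) (hε : 0 < ε) :
    ∃ p : MvPolynomial (Fin n) ℝ, ∀ α ∈ Zn n, ∀ x ∈ cubeB n,
      |Dmix n α (fun y => MvPolynomial.eval y p) x - F α x| ≤ ε := by
  obtain ⟨p, hp⟩ := exists_polyDeriv_near (List.finRange n) (List.nodup_finRange n) F
    (fun α hα i _ => hder α hα i) hcont hε
  refine ⟨p, fun α hα x hx => ?_⟩
  rw [Dmix_eval]
  exact hp α hα (fun i hi => absurd (List.mem_finRange i) hi) x hx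
end

section
/- Let Ω ⊂ ℝⁿ be bounded with radius r in the norm ‖·‖_∞, set B_r = {x ∈ ℝⁿ : ‖x‖_∞ ≤ r}, and let f : ℝⁿ → ℝⁿ be uniformly bounded on B_r. Suppose there exists v : B_r → ℝ such that for every α ∈ Zⁿ = {0,1}ⁿ the mixed partial derivative D^α v exists and is twice continuously differentiable on B_r, and suppose there are constants β₀, γ₀, δ₀ > 0 with β₀‖x‖₂² ≤ v(x) ≤ γ₀‖x‖₂² and ∇v(x)ᵀ f(x) ≤ −δ₀‖x‖₂² for all x ∈ Ω. Then for any β < β₀, γ > γ₀, and δ < δ₀ with β, γ, δ > 0, there exists a polynomial p in n variables such that β‖x‖₂² ≤ p(x) ≤ γ‖x‖₂² and ∇p(x)ᵀ f(x) ≤ −δ‖x‖₂² for all x ∈ Ω. -/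
/-- The cube `B_r = {x ∈ ℝⁿ : ‖x‖_∞ ≤ r}`. -/
def cubeR (n : ℕ) (r : ℝ) : Set (Fin n → ℝ) := {x | ∀ i, |x i| ≤ r}

/-- The squared Euclidean norm `‖x‖₂² = xᵀx = ∑ₖ x_k²`. -/
def sqnorm (n : ℕ) (x : Fin n → ℝ) : ℝ := ∑ k, x k ^ 2

namespace MvPolynomial

variable {σ : Type*}

/-- The substitution `X j ↦ 0`. -/
noncomputable def setZero [DecidableEq σ] (j : σ) :
    MvPolynomial σ ℝ →ₐ[ℝ] MvPolynomial σ ℝ :=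
  bind₁ (Function.update X j 0)

/-- The primitive of a polynomial in the variable `X j` that vanishes at `X j = 0`. -/
noncomputable def primitive (j : σ) :
    MvPolynomial σ ℝ →ₗ[ℝ] MvPolynomial σ ℝ :=
  (basisMonomials σ ℝ).constr ℝ fun m => monomial (m + Finsupp.single j 1) ((m j + 1 : ℝ)⁻¹)

theorem eval_setZero [DecidableEq σ] (j : σ) (x : σ → ℝ) (p : MvPolynomial σ ℝ) :
    eval x (setZero j p) = eval (Function.update x j 0) p := by
  rw [setZero]
  induction p using MvPolynomial.induction_on with
  | C a => simp
  | add p q hp hq => simp only [map_add, hp, hq]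
  | mul_X p k hp =>
    rcases eq_or_ne k j with rfl | hk
    · simp
    · simp [hp, hk]

theorem pderiv_setZero_self [DecidableEq σ] (j : σ) (p : MvPolynomial σ ℝ) :
    pderiv j (setZero j p) = 0 := by
  rw [setZero]
  induction p using MvPolynomial.induction_on with
  | C a => simp
  | add p q hp hq => simp only [map_add, hp, hq, add_zero]
  | mul_X p k hp =>
    rcases eq_or_ne k j with rfl | hk
    · simp
    · simp [hp, hk, pderiv_X_of_ne hk]

theorem pderiv_setZero_of_ne [DecidableEq σ] {i j : σ} (hij : i ≠ j) (p : MvPolynomial σ ℝ) :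
    pderiv i (setZero j p) = setZero j (pderiv i p) := by
  rw [setZero]
  induction p using MvPolynomial.induction_on with
  | C a => simp
  | add p q hp hq => simp only [map_add, hp, hq]
  | mul_X p k hp =>
    rcases eq_or_ne k j with rfl | hk
    · simp [pderiv_X_of_ne hij.symm]
    · rcases eq_or_ne k i with rfl | hki
      · simp [hp, hk]
      · simp [hp, hk, pderiv_X_of_ne hki]

theorem primitive_monomial (j : σ) (m : σ →₀ ℕ) (a : ℝ) :
    primitive j (monomial m a) =
      monomial (m + Finsupp.single j 1) (a * ((m j + 1 : ℝ)⁻¹)) := by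
  have h : monomial m a = a • basisMonomials σ ℝ m := by
    simp [smul_monomial]
  rw [h, map_smul, primitive, Module.Basis.constr_basis, smul_monomial, smul_eq_mul]

theorem pderiv_primitive_self (j : σ) (p : MvPolynomial σ ℝ) :
    pderiv j (primitive j p) = p := by
  induction p using MvPolynomial.induction_on' with
  | monomial m a =>
    have h : (m j + 1 : ℝ) ≠ 0 := by positivity
    rw [primitive_monomial, pderiv_monomial]
    simp [h]
  | add p q hp hq => simp only [map_add, hp, hq]

theorem pderiv_primitive_of_ne {i j : σ} (hij : i ≠ j) (p : MvPolynomial σ ℝ) :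
    pderiv i (primitive j p) = primitive j (pderiv i p) := by
  classical
  induction p using MvPolynomial.induction_on' with
  | monomial m a =>
    rw [primitive_monomial, pderiv_monomial, pderiv_monomial, primitive_monomial]
    rcases Nat.eq_zero_or_pos (m i) with h | h
    · simp [h, hij, hij.symm]
    · have hm : m + Finsupp.single j 1 - Finsupp.single i 1 =
          m - Finsupp.single i 1 + Finsupp.single j 1 := by
        ext k
        rcases eq_or_ne k i with rfl | hk
        · simp [hij]
        · simp [Finsupp.single_apply, hk.symm]
      rw [hm]
      congr 1
      simp [hij, hij.symm]
      ring
  | add p q hp hq => simp only [map_add, hp, hq]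

theorem eval_primitive_of_eq_zero (j : σ) {x : σ → ℝ} (hx : x j = 0) (p : MvPolynomial σ ℝ) :
    eval x (primitive j p) = 0 := by
  induction p using MvPolynomial.induction_on' with
  | monomial m a =>
    rw [primitive_monomial, monomial_add_single]
    simp [hx]
  | add p q hp hq => simp only [map_add, hp, hq, add_zero]

theorem hasDerivAt_eval_update [DecidableEq σ] (i : σ) (x : σ → ℝ) (t : ℝ) (p : MvPolynomial σ ℝ) :
    HasDerivAt (fun s : ℝ => eval (Function.update x i s) p)
      (eval (Function.update x i t) (pderiv i p)) t := by
  induction p using MvPolynomial.induction_on with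
  | C a => simpa using hasDerivAt_const t a
  | add p q hp hq => simpa using hp.fun_add hq
  | mul_X p k hp =>
    rcases eq_or_ne k i with rfl | hk
    · simpa [pderiv_mul, add_comm, mul_comm] using hp.fun_mul (hasDerivAt_id' t)
    · simpa [pderiv_mul, hk, pderiv_X_of_ne hk, mul_comm] using hp.mul_const (x k)

end MvPolynomial

open scoped Topology
open Asymptotics

theorem ContDiffAt.isLittleO_second_order {E : Type*} [NormedAddCommGroup E] [NormedSpace ℝ E]
    {h : E → ℝ} (hh : ContDiffAt ℝ 2 h 0) :
    (fun x => h x - (h 0 + fderiv ℝ h 0 x + 2⁻¹ * fderiv ℝ (fderiv ℝ h) 0 x x)) =o[𝓝 0]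
      fun x => ‖x‖ ^ 2 := by
  have hdiff : ∀ᶠ x in 𝓝 (0 : E), DifferentiableAt ℝ h x :=
    (hh.eventually (by simp)).mono fun x hx => hx.differentiableAt (by simp)
  set L := fderiv ℝ h 0
  set B := fderiv ℝ (fderiv ℝ h) 0
  have hsymm : ∀ x y, B x y = B y x := fun x y =>
    hh.isSymmSndFDerivAt (by simp) x y
  have hB : HasFDerivAt (fderiv ℝ h) B 0 :=
    ((hh.fderiv_right (m := 1) (by norm_num)).differentiableAt (by simp)).hasFDerivAt
  have hR : ∀ᶠ x in 𝓝 (0 : E),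
      HasFDerivAt (fun x => h x - (h 0 + L x + 2⁻¹ * B x x)) (fderiv ℝ h x - L - B x) x := by
    filter_upwards [hdiff] with x hx
    have hq : HasFDerivAt (fun x => B x x) _ x := (B.hasFDerivAt (x := x)).clm_apply (hasFDerivAt_id x)
    have h1 := hx.hasFDerivAt.fun_sub (((L.hasFDerivAt (x := x)).const_add (h 0)).fun_add
      (hq.const_mul 2⁻¹))
    refine h1.congr_fderiv ?_
    ext y
    simp [hsymm y x]
    ring
  rw [isLittleO_iff]
  intro c hc
  have ho := (isLittleO_iff.1 hB.isLittleO) hc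
  obtain ⟨ε, hε, hball⟩ := Metric.eventually_nhds_iff_ball.1 (hR.and ho)
  filter_upwards [Metric.ball_mem_nhds (0 : E) hε] with x hx
  have hx' : ‖x‖ < ε := by simpa using hx
  have hsub : ∀ y ∈ Metric.closedBall (0 : E) ‖x‖, y ∈ Metric.ball (0 : E) ε := fun y hy => by
    simp at hy ⊢; linarith
  have hmv := (convex_closedBall (0 : E) ‖x‖).norm_image_sub_le_of_norm_hasFDerivWithin_le
    (C := c * ‖x‖) (fun y hy => ((hball y (hsub y hy)).1).hasFDerivWithinAt)
    (fun y hy => by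
      have h1 := (hball y (hsub y hy)).2
      have h2 : ‖y‖ ≤ ‖x‖ := by simpa using hy
      simp only [sub_zero] at h1
      exact h1.trans (by gcongr))
    (Metric.mem_closedBall_self (norm_nonneg x)) (by simp : x ∈ _)
  simpa [sq, mul_assoc] using hmv

theorem exists_mvPolynomial_near_of_isCompact {n : ℕ} {K : Set (Fin n → ℝ)} (hK : IsCompact K)
    {g : (Fin n → ℝ) → ℝ} (hg : ContinuousOn g K) {ε : ℝ} (hε : 0 < ε) :
    ∃ q : MvPolynomial (Fin n) ℝ, ∀ x ∈ K, |MvPolynomial.eval x q - g x| < ε := by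
  have : CompactSpace K := isCompact_iff_compactSpace.1 hK
  let φ : MvPolynomial (Fin n) ℝ →ₐ[ℝ] C(K, ℝ) :=
    MvPolynomial.aeval fun i => ⟨fun x => x.1 i, (continuous_apply i).comp continuous_subtype_val⟩
  have hφ : ∀ p x, φ p x = MvPolynomial.eval x.1 p := by
    intro p x
    induction p using MvPolynomial.induction_on with
    | C a => simp [φ]
    | add p q hp hq => simp [hp, hq]
    | mul_X p k hp => simp [hp, φ]
  have hsep : φ.range.SeparatesPoints := by
    intro x y hxy
    obtain ⟨i, hi⟩ := Function.ne_iff.1 (Subtype.coe_ne_coe.2 hxy)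
    exact ⟨_, ⟨φ (MvPolynomial.X i), ⟨_, rfl⟩, rfl⟩, by simpa [hφ] using hi⟩
  obtain ⟨⟨_, p, rfl⟩, hp⟩ :=
    ContinuousMap.exists_mem_subalgebra_near_continuous_of_separatesPoints φ.range hsep
      (K.domRestrict g) hg.domRestrict ε hε
  exact ⟨p, fun x hx => by simpa [hφ] using hp ⟨x, hx⟩⟩

theorem exists_mvPolynomial_eval_eq_quadratic {n : ℕ} (c : ℝ) (L : (Fin n → ℝ) →L[ℝ] ℝ)
    (B : (Fin n → ℝ) →L[ℝ] (Fin n → ℝ) →L[ℝ] ℝ) :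
    ∃ p : MvPolynomial (Fin n) ℝ, ∀ x, MvPolynomial.eval x p = c + L x + 2⁻¹ * B x x := by
  have hlin : ∀ (L : (Fin n → ℝ) →L[ℝ] ℝ) x, L x = ∑ i, x i * L (Pi.single i 1) := fun L x => by
    conv_lhs => rw [← Finset.univ_sum_single x, map_sum]
    refine Finset.sum_congr rfl fun i _ => ?_
    rw [← smul_eq_mul, ← map_smul, ← Pi.single_smul, smul_eq_mul, mul_one]
  refine ⟨.C c + ∑ i, .X i * .C (L (Pi.single i 1)) +
    .C 2⁻¹ * ∑ i, .X i * ∑ j, .X j * .C (B (Pi.single j 1) (Pi.single i 1)), fun x => ?_⟩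
  rw [hlin L x, hlin (B x) x]
  have hflip (i : Fin n) : B x (Pi.single i 1) = ∑ j, x j * B (Pi.single j 1) (Pi.single i 1) :=
    hlin (B.flip (Pi.single i 1)) x
  simp [hflip]

theorem cubeR_eq_closedBall (n : ℕ) {r : ℝ} (hr : 0 ≤ r) :
    cubeR n r = Metric.closedBall 0 r := by
  ext x
  simp [cubeR, pi_norm_le_iff_of_nonneg hr]

theorem sqnorm_nonneg (n : ℕ) (x : Fin n → ℝ) : 0 ≤ sqnorm n x :=
  Finset.sum_nonneg fun _ _ => sq_nonneg _

theorem norm_sq_le_sqnorm (n : ℕ) (x : Fin n → ℝ) : ‖x‖ ^ 2 ≤ sqnorm n x := by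
  refine (Real.le_sqrt (norm_nonneg x) (sqnorm_nonneg n x)).1 ?_
  refine (pi_norm_le_iff_of_nonneg (Real.sqrt_nonneg _)).2 fun i => Real.abs_le_sqrt ?_
  exact Finset.single_le_sum (f := fun k => x k ^ 2) (fun _ _ => sq_nonneg _) (Finset.mem_univ i)

theorem sqnorm_update_le {n : ℕ} (x : Fin n → ℝ) (j : Fin n) {t : ℝ} (ht : |t| ≤ |x j|) :
    sqnorm n (Function.update x j t) ≤ sqnorm n x := by
  refine Finset.sum_le_sum fun k _ => ?_
  rcases eq_or_ne k j with rfl | hk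
  · simpa using sq_le_sq.2 ht
  · simp [hk]

theorem update_mem_cubeR {n : ℕ} {r : ℝ} {x : Fin n → ℝ} (hx : x ∈ cubeR n r) (j : Fin n)
    {t : ℝ} (ht : |t| ≤ r) : Function.update x j t ∈ cubeR n r := by
  intro k
  rcases eq_or_ne k j with rfl | hk
  · simpa using ht
  · simpa [hk] using hx k

theorem exists_mvPolynomial_near_of_contDiffOn {n : ℕ} {r : ℝ} (hr : 0 < r)
    {h : (Fin n → ℝ) → ℝ} (hh : ContDiffOn ℝ 2 h (cubeR n r)) {ε : ℝ} (hε : 0 < ε) :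
    ∃ p : MvPolynomial (Fin n) ℝ, ∀ x ∈ cubeR n r,
      |MvPolynomial.eval x p - h x| ≤ ε * sqnorm n x := by
  have hball := cubeR_eq_closedBall n hr.le
  have hat : ContDiffAt ℝ 2 h 0 :=
    hh.contDiffAt (hball ▸ Metric.closedBall_mem_nhds 0 hr)
  obtain ⟨T, hT⟩ := exists_mvPolynomial_eval_eq_quadratic (h 0) (fderiv ℝ h 0)
    (fderiv ℝ (fderiv ℝ h) 0)
  have hlo : (fun x => h x - MvPolynomial.eval x T) =o[𝓝 0] sqnorm n := by
    simp only [hT]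
    refine hat.isLittleO_second_order.trans_isBigO (IsBigO.of_bound 1 (.of_forall fun x => ?_))
    rw [one_mul, Real.norm_of_nonneg (by positivity), Real.norm_of_nonneg (sqnorm_nonneg n x)]
    exact norm_sq_le_sqnorm n x
  have hsq : Continuous (sqnorm n) := by unfold sqnorm; fun_prop
  have hzero : ∀ x, sqnorm n x = 0 → x = 0 := fun x hx => by
    have := norm_sq_le_sqnorm n x
    rw [hx] at this
    exact norm_eq_zero.1 (pow_eq_zero_iff two_ne_zero |>.1 (le_antisymm this (sq_nonneg _)))
  have hsq0 : sqnorm n 0 = 0 := by simp [sqnorm]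
  have hcont : ContinuousOn (fun x => (h x - MvPolynomial.eval x T) / sqnorm n x)
      (cubeR n r) := by
    intro x hx
    rcases eq_or_ne x 0 with rfl | hx0
    · refine ContinuousAt.continuousWithinAt ?_
      rw [ContinuousAt, hsq0, div_zero]
      exact hlo.tendsto_div_nhds_zero
    · exact ((hh.continuousOn x hx).sub T.continuous_eval.continuousWithinAt).div
        hsq.continuousWithinAt fun h0 => hx0 (hzero x h0)
  obtain ⟨q, hq⟩ := exists_mvPolynomial_near_of_isCompact
    (hball ▸ isCompact_closedBall 0 r) hcont hε
  refine ⟨T + (∑ k, .X k ^ 2) * q, fun x hx => ?_⟩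
  have heval : MvPolynomial.eval x (T + (∑ k, .X k ^ 2) * q) =
      MvPolynomial.eval x T + sqnorm n x * MvPolynomial.eval x q := by
    simp [sqnorm]
  rw [heval]
  rcases eq_or_ne (sqnorm n x) 0 with h0 | h0
  · obtain rfl := hzero x h0
    rw [hT]
    simp [h0]
  · have hdiff : MvPolynomial.eval x T + sqnorm n x * MvPolynomial.eval x q - h x =
        (MvPolynomial.eval x q - (h x - MvPolynomial.eval x T) / sqnorm n x) * sqnorm n x := by
      field_simp
      ring
    rw [hdiff, abs_mul, abs_of_nonneg (sqnorm_nonneg n x)]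
    exact mul_le_mul_of_nonneg_right (hq x hx).le (sqnorm_nonneg n x)

theorem mem_Zn_iff {n : ℕ} {α : Fin n → ℕ} : α ∈ Zn n ↔ ∀ i, α i = 0 ∨ α i = 1 := by
  simp [Zn]

theorem add_single_mem_Zn {n : ℕ} {α : Fin n → ℕ} (hα : α ∈ Zn n) {i : Fin n} (hi : α i = 0) :
    α + Pi.single i 1 ∈ Zn n := by
  rw [mem_Zn_iff] at hα ⊢
  intro k
  rcases eq_or_ne k i with rfl | hk
  · simp [hi]
  · simpa [hk] using hα k

/-- A family approximating all `D^α v` within `ε‖x‖₂²` can be chosen to be compatible with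
differentiation in any prescribed set of variables. -/
theorem exists_compatible_mvPolynomial_family {n : ℕ} {r : ℝ} (hr : 0 < r)
    {F : (Fin n → ℕ) → (Fin n → ℝ) → ℝ}
    (hder : ∀ α ∈ Zn n, ∀ i : Fin n, α i = 0 → ∀ x ∈ cubeR n r,
      HasDerivAt (fun t : ℝ => F α (Function.update x i t))
        (F (α + Pi.single i 1) x) (x i))
    (hsmooth : ∀ α ∈ Zn n, ContDiffOn ℝ 2 (F α) (cubeR n r)) (S : Finset (Fin n)) :
    ∀ ε > 0, ∃ P : (Fin n → ℕ) → MvPolynomial (Fin n) ℝ,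
      (∀ α ∈ Zn n, ∀ x ∈ cubeR n r, |MvPolynomial.eval x (P α) - F α x| ≤ ε * sqnorm n x) ∧
      ∀ α ∈ Zn n, ∀ i ∈ S, α i = 0 →
        MvPolynomial.pderiv i (P α) = P (α + Pi.single i 1) := by
  induction S using Finset.induction_on with
  | empty =>
    intro ε hε
    have hex : ∀ α, ∃ p : MvPolynomial (Fin n) ℝ, α ∈ Zn n → ∀ x ∈ cubeR n r,
        |MvPolynomial.eval x p - F α x| ≤ ε * sqnorm n x := fun α => by
      by_cases hα : α ∈ Zn n
      · obtain ⟨p, hp⟩ := exists_mvPolynomial_near_of_contDiffOn hr (hsmooth α hα) hε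
        exact ⟨p, fun _ => hp⟩
      · exact ⟨0, fun h => absurd h hα⟩
    choose P hP using hex
    exact ⟨P, hP, by simp⟩
  | insert j S hj ih =>
    intro ε hε
    obtain ⟨P, hP, hPd⟩ := ih (ε / (1 + r)) (by positivity)
    set η := ε / (1 + r) with hη
    have hη0 : 0 < η := by positivity
    have hηε : η * (1 + r) = ε := by rw [hη]; field_simp
    refine ⟨fun α => if α j = 0 then
      (P α).setZero j + (P (α + Pi.single j 1)).primitive j else P α, ?_, ?_⟩
    · intro α hα x hx
      by_cases hαj : α j = 0
      · simp only [hαj, if_true]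
        set Q := (P α).setZero j + (P (α + Pi.single j 1)).primitive j with hQ
        have hQj : MvPolynomial.pderiv j Q = P (α + Pi.single j 1) := by
          rw [hQ, map_add, MvPolynomial.pderiv_setZero_self, MvPolynomial.pderiv_primitive_self,
            zero_add]
        have hbd : ∀ t ∈ Metric.closedBall (0 : ℝ) |x j|, |t| ≤ |x j| := fun t ht => by
          simpa using ht
        have hmv := (convex_closedBall (0 : ℝ) |x j|).norm_image_sub_le_of_norm_hasDerivWithin_le
          (f := fun t => MvPolynomial.eval (Function.update x j t) Q - F α (Function.update x j t))
          (f' := fun t => MvPolynomial.eval (Function.update x j t) (P (α + Pi.single j 1)) -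
            F (α + Pi.single j 1) (Function.update x j t))
          (C := η * sqnorm n x) (x := 0) (y := x j)
          (fun t ht => by
            have hd := hder α hα j hαj _ (update_mem_cubeR hx j ((hbd t ht).trans (hx j)))
            simp only [Function.update_idem, Function.update_self] at hd
            have hp := MvPolynomial.hasDerivAt_eval_update j x t Q
            rw [hQj] at hp
            exact (hp.fun_sub hd).hasDerivWithinAt)
          (fun t ht => (hP _ (add_single_mem_Zn hα hαj) _
            (update_mem_cubeR hx j ((hbd t ht).trans (hx j)))).trans
              (mul_le_mul_of_nonneg_left (sqnorm_update_le x j (hbd t ht)) hη0.le))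
          (by simp) (by simp)
        have h0 : MvPolynomial.eval (Function.update x j 0) Q =
            MvPolynomial.eval (Function.update x j 0) (P α) := by
          rw [hQ, map_add, MvPolynomial.eval_setZero,
            MvPolynomial.eval_primitive_of_eq_zero j (by simp), Function.update_idem, add_zero]
        have hz := (hP α hα _ (update_mem_cubeR hx j (t := 0) (by simpa using hr.le))).trans
          (mul_le_mul_of_nonneg_left (sqnorm_update_le x j (t := 0) (by simp)) hη0.le)
        simp only [Function.update_eq_self, h0, sub_zero, Real.norm_eq_abs] at hmv
        have hxr : η * sqnorm n x * |x j| ≤ η * sqnorm n x * r :=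
          mul_le_mul_of_nonneg_left (hx j) (mul_nonneg hη0.le (sqnorm_nonneg n x))
        have htri := abs_sub_abs_le_abs_sub (MvPolynomial.eval x Q - F α x)
          (MvPolynomial.eval (Function.update x j 0) (P α) - F α (Function.update x j 0))
        rw [← hηε]
        linarith
      · simp only [hαj, if_false]
        refine (hP α hα x hx).trans (mul_le_mul_of_nonneg_right ?_ (sqnorm_nonneg n x))
        nlinarith
    · intro α hα i hi hαi
      rcases eq_or_ne i j with rfl | hij
      · simp [hαi, MvPolynomial.pderiv_setZero_self, MvPolynomial.pderiv_primitive_self]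
      · have hiS : i ∈ S := (Finset.mem_insert.1 hi).resolve_left hij
        by_cases hαj : α j = 0
        · simp [hαj, hij.symm, MvPolynomial.pderiv_setZero_of_ne hij,
            MvPolynomial.pderiv_primitive_of_ne hij, hPd α hα i hiS hαi,
            hPd _ (add_single_mem_Zn hα hαj) i hiS (by simp [hαi, hij]),
            add_right_comm α (Pi.single j 1)]
        · simpa [hαj, hij.symm] using hPd α hα i hiS hαi

/-- let `Ω ⊆ B_r`, and let `f : ℝⁿ → ℝⁿ` be uniformly bounded on
`B_r`.  Suppose `v = F 0 : B_r → ℝ` is such that every mixed partial derivative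
`D^α v` with `α ∈ Zⁿ = {0,1}ⁿ` exists and is twice continuously differentiable
on `B_r` (the family `{D^α v}` is encoded by `F`, with `F (α + eᵢ)` the partial
derivative of `F α` in the `i`-th variable on `B_r`), and that for some
`β₀, γ₀, δ₀ > 0` we have `β₀‖x‖₂² ≤ v(x) ≤ γ₀‖x‖₂²` and
`∇v(x)ᵀ f(x) ≤ −δ₀‖x‖₂²` on `Ω`.  Then for any positive `β < β₀`, `γ > γ₀`,
`δ < δ₀` there is a polynomial `p` with `β‖x‖₂² ≤ p(x) ≤ γ‖x‖₂²` and
`∇p(x)ᵀ f(x) ≤ −δ‖x‖₂²` for all `x ∈ Ω`. -/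
theorem poly_lyapunov_approx (n : ℕ) (r : ℝ) (hr : 0 < r)
    (Ω : Set (Fin n → ℝ)) (hΩ : Ω ⊆ cubeR n r)
    (f : (Fin n → ℝ) → (Fin n → ℝ))
    (hfb : ∃ b : ℝ, ∀ x ∈ cubeR n r, ∀ i, |f x i| ≤ b)
    (v : (Fin n → ℝ) → ℝ) (F : (Fin n → ℕ) → (Fin n → ℝ) → ℝ) (hF0 : F 0 = v)
    (hder : ∀ α ∈ Zn n, ∀ i : Fin n, α i = 0 → ∀ x ∈ cubeR n r,
      HasDerivAt (fun t : ℝ => F α (Function.update x i t))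
        (F (α + Pi.single i 1) x) (x i))
    (hsmooth : ∀ α ∈ Zn n, ContDiffOn ℝ 2 (F α) (cubeR n r))
    (β₀ γ₀ δ₀ : ℝ) (hβ₀ : 0 < β₀) (hγ₀ : 0 < γ₀) (hδ₀ : 0 < δ₀)
    (hlow : ∀ x ∈ Ω, β₀ * sqnorm n x ≤ v x)
    (hhigh : ∀ x ∈ Ω, v x ≤ γ₀ * sqnorm n x)
    (hdec : ∀ x ∈ Ω, ∑ i, F (Pi.single i 1) x * f x i ≤ -δ₀ * sqnorm n x)
    (β γ δ : ℝ) (hβpos : 0 < β) (hγpos : 0 < γ) (hδpos : 0 < δ)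
    (hβ : β < β₀) (hγ : γ₀ < γ) (hδ : δ < δ₀) :
    ∃ p : MvPolynomial (Fin n) ℝ, ∀ x ∈ Ω,
      β * sqnorm n x ≤ MvPolynomial.eval x p ∧
      MvPolynomial.eval x p ≤ γ * sqnorm n x ∧
      ∑ i, pd n i (fun y => MvPolynomial.eval y p) x * f x i ≤ -δ * sqnorm n x := by
  obtain ⟨b, hb⟩ := hfb
  set B := max b 0
  set ε := min (min (β₀ - β) (γ - γ₀)) ((δ₀ - δ) / (n * B + 1)) with hε
  have hB : 0 ≤ B := le_max_right _ _
  have hnB : 0 < n * B + 1 := by positivity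
  have hε0 : 0 < ε := lt_min (lt_min (by linarith) (by linarith)) (div_pos (by linarith) hnB)
  have hε1 : ε ≤ β₀ - β := (min_le_left _ _).trans (min_le_left _ _)
  have hε2 : ε ≤ γ - γ₀ := (min_le_left _ _).trans (min_le_right _ _)
  have hε3 : ε * (n * B) ≤ δ₀ - δ := by
    have := (le_div_iff₀ hnB).1 (min_le_right _ _ : ε ≤ (δ₀ - δ) / (n * B + 1))
    linarith
  obtain ⟨P, hP, hPd⟩ := exists_compatible_mvPolynomial_family hr hder hsmooth Finset.univ ε hε0
  have h0 : (0 : Fin n → ℕ) ∈ Zn n := mem_Zn_iff.2 (by simp)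
  refine ⟨P 0, fun x hx => ?_⟩
  have hxc := hΩ hx
  have hs := sqnorm_nonneg n x
  have hv := abs_le.1 (hP 0 h0 x hxc)
  rw [hF0] at hv
  refine ⟨?_, ?_, ?_⟩
  · nlinarith [hlow x hx]
  · nlinarith [hhigh x hx]
  · have hpd : ∀ i, pd n i (fun y => MvPolynomial.eval y (P 0)) x =
        MvPolynomial.eval x (P (Pi.single i 1)) := fun i => by
      have h := (MvPolynomial.hasDerivAt_eval_update i x (x i) (P 0)).deriv
      rw [hPd 0 h0 i (Finset.mem_univ i) rfl, zero_add, Function.update_eq_self] at h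
      exact h
    have hterm : ∀ i, pd n i (fun y => MvPolynomial.eval y (P 0)) x * f x i ≤
        F (Pi.single i 1) x * f x i + ε * sqnorm n x * B := fun i => by
      have h1 := hP (Pi.single i 1) (by simpa using add_single_mem_Zn h0 (i := i) rfl) x hxc
      have h2 : |f x i| ≤ B := (hb x hxc i).trans (le_max_left _ _)
      have h3 := mul_le_mul h1 h2 (abs_nonneg _) (mul_nonneg hε0.le hs)
      rw [← abs_mul] at h3
      rw [hpd]
      linarith [(abs_le.1 h3).2]
    have hsum := Finset.sum_le_sum fun i (_ : i ∈ Finset.univ) => hterm i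
    rw [Finset.sum_add_distrib, Finset.sum_const, Finset.card_univ, Fintype.card_fin,
      nsmul_eq_mul] at hsum
    nlinarith [hdec x hx, mul_le_mul_of_nonneg_right hε3 hs]
end

section
/- Consider the ordinary differential equation ẋ(t) = f(x(t)) where f : ℝⁿ → ℝⁿ is a polynomial vector field with f(0) = 0. Suppose solutions exist, are unique, and there are constants μ, δ, r > 0 such that every solution x(·) with ‖x(0)‖₂ ≤ r satisfies ‖x(t)‖₂ ≤ μ‖x(0)‖₂ e^{−δt} for all t ≥ 0. Then there exists a polynomial v : ℝⁿ → ℝ and constants α, β, γ > 0 such that α‖x‖₂² ≤ v(x) ≤ β‖x‖₂² and ∇v(x)ᵀ f(x) ≤ −γ‖x‖₂² for all x with ‖x‖₂ ≤ r; i.e., exponentially stable polynomial ODEs admit polynomial Lyapunov functions. -/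
/-- The Euclidean norm `‖x‖₂ = √(xᵀx)`. -/
noncomputable def enorm2 (n : ℕ) (x : Fin n → ℝ) : ℝ := Real.sqrt (sqnorm n x)

/-- One step of the explicit Euler scheme with step size `h` for `ẋ = f(x)`. -/
def eulerStep {E : Type*} [AddCommGroup E] [Module ℝ E] (f : E → E) (h : ℝ) (x : E) : E :=
  x + h • f x

/-- The left Riemann sum, along `N` steps of the explicit Euler scheme, of the squared norm. -/
def eulerEnergy {E : Type*} [NormedAddCommGroup E] [NormedSpace ℝ E] (f : E → E) (h : ℝ) (N : ℕ)
    (x : E) : ℝ :=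
  ∑ j ∈ Finset.range N, h * ‖(eulerStep f h)^[j] x‖ ^ 2

/-- A discrete Grönwall inequality with a continuation hypothesis: the recursive bound at step `j`
is only required when `a j` already satisfies the conclusion. -/
theorem discrete_gronwall_of_continuation {a : ℕ → ℝ} {h L A T : ℝ} {N : ℕ} (hh : 0 ≤ h) (hL : 0 ≤ L)
    (hA : 0 ≤ A) (hT : N * h = T) (h0 : a 0 ≤ 0)
    (hstep : ∀ j < N, a j ≤ h * (T * A * Real.exp (L * T)) →
      a (j + 1) ≤ (1 + h * L) * a j + h ^ 2 * A) :
    ∀ j ≤ N, a j ≤ h * (T * A * Real.exp (L * T)) := by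
  have hq : (1 : ℝ) ≤ 1 + h * L := by nlinarith [mul_nonneg hh hL]
  have key : ∀ j ≤ N, j * h ^ 2 * A * (1 + h * L) ^ j ≤ h * (T * A * Real.exp (L * T)) := by
    intro j hj
    have hjN : (j : ℝ) ≤ N := by exact_mod_cast hj
    have hjT : j * h ≤ T := hT ▸ mul_le_mul_of_nonneg_right hjN hh
    have hpow : (1 + h * L) ^ j ≤ Real.exp (L * T) := by
      calc (1 + h * L) ^ j ≤ Real.exp (h * L) ^ j := by
            gcongr
            linarith [Real.add_one_le_exp (h * L)]
        _ = Real.exp (j * (h * L)) := (Real.exp_nat_mul _ _).symm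
        _ ≤ Real.exp (L * T) := Real.exp_le_exp.2 (by nlinarith)
    calc j * h ^ 2 * A * (1 + h * L) ^ j = h * ((j * h) * A * (1 + h * L) ^ j) := by ring
      _ ≤ h * (T * A * Real.exp (L * T)) := by
        have : 0 ≤ T := le_trans (by positivity) hjT
        gcongr
  have main : ∀ j ≤ N, a j ≤ j * h ^ 2 * A * (1 + h * L) ^ j := by
    intro j
    induction j with
    | zero => intro _; simpa using h0
    | succ j ih =>
      intro hj
      have ihj := ih (by omega)
      have hpow : (1 : ℝ) ≤ (1 + h * L) ^ (j + 1) := one_le_pow₀ hq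
      calc a (j + 1) ≤ (1 + h * L) * a j + h ^ 2 * A :=
            hstep j (by omega) (ihj.trans (key j (by omega)))
        _ ≤ (1 + h * L) * (j * h ^ 2 * A * (1 + h * L) ^ j) + h ^ 2 * A * (1 + h * L) ^ (j + 1) := by
            refine add_le_add (by gcongr) (le_mul_of_one_le_right (by positivity) hpow)
        _ = (j + 1 : ℕ) * h ^ 2 * A * (1 + h * L) ^ (j + 1) := by push_cast; ring
  exact fun j hj => (main j hj).trans (key j hj)

section

variable {E : Type*} [NormedAddCommGroup E] [InnerProductSpace ℝ E]

/-- On a bounded ball, a `C²` map of a finite-dimensional space has a bounded and Lipschitz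
derivative. -/
theorem ContDiff.exists_fderiv_bounds_closedBall [FiniteDimensional ℝ E] {f : E → E}
    (hf : ContDiff ℝ 2 f) (R : ℝ) :
    ∃ L M : ℝ, 0 ≤ L ∧ 0 ≤ M ∧ (∀ x ∈ Metric.closedBall (0 : E) R, ‖fderiv ℝ f x‖ ≤ L) ∧
      ∀ x ∈ Metric.closedBall (0 : E) R, ∀ y ∈ Metric.closedBall (0 : E) R,
        ‖fderiv ℝ f y - fderiv ℝ f x‖ ≤ M * ‖y - x‖ := by
  have hf1 : ContDiff ℝ 1 (fderiv ℝ f) := hf.fderiv_right (by norm_num)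
  have hK := isCompact_closedBall (0 : E) R
  obtain ⟨L, hL⟩ := hK.exists_bound_of_continuousOn hf1.continuous.continuousOn
  obtain ⟨M, hM⟩ := hK.exists_bound_of_continuousOn
    (hf1.continuous_fderiv one_ne_zero).continuousOn
  refine ⟨max L 0, max M 0, le_max_right _ _, le_max_right _ _,
    fun x hx => (hL x hx).trans (le_max_left _ _), fun x hx y hy => ?_⟩
  exact (convex_closedBall _ _).norm_image_sub_le_of_norm_fderiv_le
    (fun z _ => (hf1.differentiable one_ne_zero).differentiableAt)
    (fun z hz => (hM z hz).trans (le_max_left _ _)) hx hy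

/-- Local truncation error of the explicit Euler scheme along an exact solution bounded by `C`. -/
theorem norm_solution_sub_eulerStep_le {f : E → E} {L C R : ℝ} (hL : 0 ≤ L)
    (hLip : ∀ x ∈ Metric.closedBall (0 : E) R, ∀ y ∈ Metric.closedBall (0 : E) R,
      ‖f y - f x‖ ≤ L * ‖y - x‖)
    (hgrow : ∀ x ∈ Metric.closedBall (0 : E) R, ‖f x‖ ≤ L * ‖x‖) (hCR : C ≤ R)
    {φ : ℝ → E} (hφ : ∀ t ≥ (0 : ℝ), HasDerivAt φ (f (φ t)) t)
    (hbd : ∀ t ≥ (0 : ℝ), ‖φ t‖ ≤ C) {t h : ℝ} (ht : 0 ≤ t) (hh : 0 ≤ h) :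
    ‖φ (t + h) - eulerStep f h (φ t)‖ ≤ h ^ 2 * (L ^ 2 * C) := by
  have hmem : ∀ s ≥ (0 : ℝ), φ s ∈ Metric.closedBall (0 : E) R := fun s hs => by
    simpa using (hbd s hs).trans hCR
  have hdrift : ∀ s ∈ Set.Icc t (t + h), ‖φ s - φ t‖ ≤ L * C * h := by
    intro s hs
    have := norm_image_sub_le_of_norm_deriv_le_segment' (f := φ) (C := L * C) (a := t) (b := t + h)
      (fun u hu => (hφ u (ht.trans hu.1)).hasDerivWithinAt)
      (fun u hu => (hgrow _ (hmem u (ht.trans hu.1))).trans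
        (mul_le_mul_of_nonneg_left (hbd u (ht.trans hu.1)) hL)) s hs
    refine this.trans ?_
    have hC : 0 ≤ C := (norm_nonneg _).trans (hbd t ht)
    have : s - t ≤ h := by linarith [hs.2]
    gcongr
  have := norm_image_sub_le_of_norm_deriv_le_segment' (f := fun s => φ s - (s - t) • f (φ t))
    (f' := fun s => f (φ s) - f (φ t))
    (C := L * (L * C * h)) (a := t) (b := t + h)
    (fun u hu => by
      have h1 := (hφ u (ht.trans hu.1)).sub
        (((hasDerivAt_id u).sub_const t).smul_const (f (φ t)))
      exact HasDerivAt.hasDerivWithinAt (by simpa [Pi.sub_def] using h1))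
    (fun u hu => (hLip _ (hmem t ht) _ (hmem u (ht.trans hu.1))).trans
      (mul_le_mul_of_nonneg_left (hdrift u ⟨hu.1, hu.2.le⟩) hL)) (t + h) ⟨by linarith, le_rfl⟩
  have e : φ (t + h) - (t + h - t) • f (φ t) - (φ t - (t - t) • f (φ t))
      = φ (t + h) - eulerStep f h (φ t) := by
    simp [eulerStep]; abel
  rw [e] at this
  refine this.trans (le_of_eq ?_)
  ring

theorem hasFDerivAt_eulerStep {f : E → E} (hf : Differentiable ℝ f) (h : ℝ) (x : E) :
    HasFDerivAt (eulerStep f h) (ContinuousLinearMap.id ℝ E + h • fderiv ℝ f x) x :=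
  (hasFDerivAt_id x).add ((hf x).hasFDerivAt.const_smul h)

theorem differentiable_eulerStep_iterate {f : E → E} (hf : Differentiable ℝ f) (h : ℝ) (j : ℕ) :
    Differentiable ℝ (eulerStep f h)^[j] :=
  Differentiable.iterate (fun x => (hasFDerivAt_eulerStep hf h x).differentiableAt) j

theorem norm_eulerStep_sub_le {f : E → E} {L R : ℝ}
    (hLip : ∀ x ∈ Metric.closedBall (0 : E) R, ∀ y ∈ Metric.closedBall (0 : E) R,
      ‖f y - f x‖ ≤ L * ‖y - x‖) {h : ℝ} (hh : 0 ≤ h) {x y : E}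
    (hx : x ∈ Metric.closedBall (0 : E) R) (hy : y ∈ Metric.closedBall (0 : E) R) :
    ‖eulerStep f h y - eulerStep f h x‖ ≤ (1 + h * L) * ‖y - x‖ := by
  have e : eulerStep f h y - eulerStep f h x = (y - x) + h • (f y - f x) := by
    simp only [eulerStep, smul_sub]; abel
  rw [e]
  calc ‖(y - x) + h • (f y - f x)‖ ≤ ‖y - x‖ + ‖h • (f y - f x)‖ := norm_add_le _ _
    _ = ‖y - x‖ + h * ‖f y - f x‖ := by rw [norm_smul, Real.norm_of_nonneg hh]
    _ ≤ ‖y - x‖ + h * (L * ‖y - x‖) := by gcongr; exact hLip x hx y hy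
    _ = _ := by ring

/-- The Euler scheme almost commutes with the vector field: the defect
`D(eulerStep)(x) f(x) - f(eulerStep x)` is of second order in `h`. -/
theorem norm_fderiv_eulerStep_sub_le {f : E → E} (hf : Differentiable ℝ f) {M R : ℝ}
    (hM0 : 0 ≤ M)
    (hM : ∀ x ∈ Metric.closedBall (0 : E) R, ∀ y ∈ Metric.closedBall (0 : E) R,
      ‖fderiv ℝ f y - fderiv ℝ f x‖ ≤ M * ‖y - x‖) {h : ℝ} (hh : 0 ≤ h) {x : E}
    (hx : x ∈ Metric.closedBall (0 : E) R) (hy : eulerStep f h x ∈ Metric.closedBall (0 : E) R) :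
    ‖f x + h • fderiv ℝ f x (f x) - f (eulerStep f h x)‖ ≤ h ^ 2 * (M * ‖f x‖ ^ 2) := by
  have hstep : eulerStep f h x - x = h • f x := by simp [eulerStep]
  have hnorm : ‖eulerStep f h x - x‖ = h * ‖f x‖ := by
    rw [hstep, norm_smul, Real.norm_of_nonneg hh]
  have hseg : segment ℝ x (eulerStep f h x) ⊆ Metric.closedBall (0 : E) R :=
    (convex_closedBall _ _).segment_subset hx hy
  have := (convex_segment x (eulerStep f h x)).norm_image_sub_le_of_norm_fderiv_le'
    (𝕜 := ℝ) (f := f) (φ := fderiv ℝ f x) (C := M * (h * ‖f x‖))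
    (fun z _ => hf z)
    (fun z hz => (hM x hx z (hseg hz)).trans (by
      rw [← hnorm]
      gcongr
      exact norm_sub_le_of_mem_segment hz))
    (left_mem_segment _ _ _) (right_mem_segment _ _ _)
  rw [hnorm] at this
  have e : f x + h • fderiv ℝ f x (f x) - f (eulerStep f h x)
      = -(f (eulerStep f h x) - f x - fderiv ℝ f x (eulerStep f h x - x)) := by
    rw [hstep, map_smul]; abel
  rw [e, norm_neg]
  exact this.trans (le_of_eq (by ring))

theorem hasFDerivAt_eulerEnergy {f : E → E} (hf : Differentiable ℝ f) (h : ℝ) (N : ℕ) (x : E) :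
    HasFDerivAt (eulerEnergy f h N)
      (∑ j ∈ Finset.range N, h • (2 • (innerSL ℝ ((eulerStep f h)^[j] x)).comp
        (fderiv ℝ (eulerStep f h)^[j] x))) x := by
  unfold eulerEnergy
  refine HasFDerivAt.fun_sum fun j _ => ?_
  exact (((differentiable_eulerStep_iterate hf h j) x).hasFDerivAt.norm_sq).const_mul h

/-- Telescoping of the discrete energy along the Euler scheme. -/
theorem sum_two_mul_inner_eulerStep_le (f : E → E) (h : ℝ) (N : ℕ) (x : E) :
    ∑ j ∈ Finset.range N, h * (2 * inner ℝ ((eulerStep f h)^[j] x) (f ((eulerStep f h)^[j] x)))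
      ≤ ‖(eulerStep f h)^[N] x‖ ^ 2 - ‖x‖ ^ 2 := by
  have := Finset.sum_range_sub (fun j => ‖(eulerStep f h)^[j] x‖ ^ 2) N
  simp only [Function.iterate_zero, id] at this
  rw [← this]
  refine Finset.sum_le_sum fun j _ => ?_
  rw [Function.iterate_succ_apply']
  set y := (eulerStep f h)^[j] x
  rw [eulerStep, norm_add_sq_real, real_inner_smul_right]
  nlinarith [sq_nonneg ‖h • f y‖]

/-- If the orbit of `x` under the Euler scheme stays in a region where `f` has good bounds and
contracts to at most half of its initial size after `N` steps, the Euler energy decreases. -/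
theorem fderiv_eulerEnergy_le {f : E → E} (hf : Differentiable ℝ f) {L M R K T h : ℝ} {N : ℕ}
    (hL : 0 ≤ L) (hM0 : 0 ≤ M) (hK : 0 ≤ K) (hh : 0 ≤ h) (hT : N * h = T)
    (hD : ∀ x ∈ Metric.closedBall (0 : E) R, ‖fderiv ℝ f x‖ ≤ L)
    (hM : ∀ x ∈ Metric.closedBall (0 : E) R, ∀ y ∈ Metric.closedBall (0 : E) R,
      ‖fderiv ℝ f y - fderiv ℝ f x‖ ≤ M * ‖y - x‖)
    (hgrow : ∀ x ∈ Metric.closedBall (0 : E) R, ‖f x‖ ≤ L * ‖x‖) {x : E}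
    (hKR : K * ‖x‖ ≤ R)
    (horb : ∀ j ≤ N, ‖(eulerStep f h)^[j] x‖ ≤ K * ‖x‖)
    (hend : ‖(eulerStep f h)^[N] x‖ ≤ ‖x‖ / 2)
    (hsmall : h * (8 * T * K * (T * (M * L ^ 2 * R * K) * Real.exp (L * T))) ≤ 1) :
    fderiv ℝ (eulerEnergy f h N) x (f x) ≤ -(1 / 2) * ‖x‖ ^ 2 := by
  set y : ℕ → E := fun j => (eulerStep f h)^[j] x with hy
  have hx0 : 0 ≤ ‖x‖ := norm_nonneg x
  have hR : 0 ≤ R := (by positivity : 0 ≤ K * ‖x‖).trans hKR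
  have hT0 : 0 ≤ T := hT ▸ by positivity
  have hmem : ∀ j ≤ N, y j ∈ Metric.closedBall (0 : E) R := fun j hj => by
    simpa using (horb j hj).trans hKR
  have hysucc : ∀ j, y (j + 1) = eulerStep f h (y j) := fun j =>
    Function.iterate_succ_apply' _ _ _
  set e : ℕ → E := fun j => fderiv ℝ (eulerStep f h)^[j] x (f x) - f (y j) with he
  have hesucc : ∀ j, e (j + 1) = (e j + h • fderiv ℝ f (y j) (e j)) +
      (f (y j) + h • fderiv ℝ f (y j) (f (y j)) - f (eulerStep f h (y j))) := by
    intro j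
    have hcomp : fderiv ℝ (eulerStep f h)^[j + 1] x =
        (ContinuousLinearMap.id ℝ E + h • fderiv ℝ f (y j)).comp
          (fderiv ℝ (eulerStep f h)^[j] x) := by
      rw [Function.iterate_succ']
      exact ((hasFDerivAt_eulerStep hf h (y j)).comp x
        (differentiable_eulerStep_iterate hf h j x).hasFDerivAt).fderiv
    simp only [he, hcomp, hysucc, ContinuousLinearMap.comp_apply, add_apply,
      smul_apply, ContinuousLinearMap.id_apply, map_sub, smul_sub]
    abel
  have hebd : ∀ j ≤ N, ‖e j‖ ≤
      h * (T * (M * L ^ 2 * R * K * ‖x‖) * Real.exp (L * T)) := by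
    refine discrete_gronwall_of_continuation hh hL (by positivity) hT (by simp [he, hy]) fun j hj _ => ?_
    rw [hesucc]
    have hyj := hmem j hj.le
    have hyj' := hmem (j + 1) hj
    rw [hysucc] at hyj'
    have h1 : ‖e j + h • fderiv ℝ f (y j) (e j)‖ ≤ (1 + h * L) * ‖e j‖ := by
      calc ‖e j + h • fderiv ℝ f (y j) (e j)‖ ≤ ‖e j‖ + ‖h • fderiv ℝ f (y j) (e j)‖ :=
            norm_add_le _ _
        _ = ‖e j‖ + h * ‖fderiv ℝ f (y j) (e j)‖ := by rw [norm_smul, Real.norm_of_nonneg hh]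
        _ ≤ ‖e j‖ + h * (L * ‖e j‖) := by
            gcongr
            exact (fderiv ℝ f (y j)).le_of_opNorm_le (hD _ hyj) _
        _ = _ := by ring
    have h2 := norm_fderiv_eulerStep_sub_le hf hM0 hM hh hyj hyj'
    have h3 : ‖f (y j)‖ ^ 2 ≤ L ^ 2 * R * K * ‖x‖ := by
      have a1 := hgrow _ hyj
      have a2 : ‖y j‖ ≤ R := by simpa using hyj
      calc ‖f (y j)‖ ^ 2 ≤ (L * ‖y j‖) ^ 2 := by gcongr
        _ = L ^ 2 * (‖y j‖ * ‖y j‖) := by ring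
        _ ≤ L ^ 2 * (R * (K * ‖x‖)) := by gcongr; exact horb j hj.le
        _ = _ := by ring
    calc _ ≤ _ := norm_add_le _ _
      _ ≤ (1 + h * L) * ‖e j‖ + h ^ 2 * (M * ‖f (y j)‖ ^ 2) := add_le_add h1 h2
      _ ≤ (1 + h * L) * ‖e j‖ + h ^ 2 * (M * (L ^ 2 * R * K * ‖x‖)) := by gcongr
      _ = _ := by ring
  have hinner : ∀ j ∈ Finset.range N, h * (2 * inner ℝ (y j) (e j)) ≤
      h * (2 * (K * ‖x‖ * (h * (T * (M * L ^ 2 * R * K * ‖x‖) * Real.exp (L * T))))) := by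
    intro j hj
    have hj' : j ≤ N := (Finset.mem_range.1 hj).le
    gcongr
    calc inner ℝ (y j) (e j) ≤ ‖y j‖ * ‖e j‖ := real_inner_le_norm _ _
      _ ≤ _ := by gcongr; exacts [horb j hj', hebd j hj']
  have hsum := Finset.sum_le_sum hinner
  rw [Finset.sum_const, Finset.card_range, nsmul_eq_mul] at hsum
  have htel := sum_two_mul_inner_eulerStep_le f h N x
  have hder : fderiv ℝ (eulerEnergy f h N) x (f x) =
      ∑ j ∈ Finset.range N, h * (2 * inner ℝ (y j) (f (y j))) +
      ∑ j ∈ Finset.range N, h * (2 * inner ℝ (y j) (e j)) := by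
    rw [(hasFDerivAt_eulerEnergy hf h N x).fderiv, ← Finset.sum_add_distrib]
    simp only [sum_apply]
    refine Finset.sum_congr rfl fun j _ => ?_
    simp only [he, hy, inner_sub_right, smul_apply, smul_eq_mul,
      ContinuousLinearMap.comp_apply, innerSL_apply_apply, nsmul_eq_mul, Nat.cast_ofNat]
    ring
  have hendsq : ‖y N‖ ^ 2 ≤ (‖x‖ / 2) ^ 2 := by gcongr
  have herr : N * (h * (2 * (K * ‖x‖ *
      (h * (T * (M * L ^ 2 * R * K * ‖x‖) * Real.exp (L * T)))))) ≤ ‖x‖ ^ 2 / 4 := by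
    calc _ = (h * (8 * (N * h) * K * (T * (M * L ^ 2 * R * K) * Real.exp (L * T)))) *
          (‖x‖ ^ 2 / 4) := by ring
      _ ≤ 1 * (‖x‖ ^ 2 / 4) := by rw [hT]; gcongr
      _ = _ := one_mul _
  rw [hder]
  simp only [hy] at hendsq hsum ⊢
  linarith

/-- The Euler scheme follows an exact solution with an error relative to the initial size. -/
theorem norm_eulerStep_iterate_sub_le {f : E → E} {L R C T h : ℝ} {N : ℕ}
    (hL : 0 ≤ L) (hh : 0 ≤ h) (hT : N * h = T)
    (hLip : ∀ x ∈ Metric.closedBall (0 : E) R, ∀ y ∈ Metric.closedBall (0 : E) R,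
      ‖f y - f x‖ ≤ L * ‖y - x‖)
    (hgrow : ∀ x ∈ Metric.closedBall (0 : E) R, ‖f x‖ ≤ L * ‖x‖)
    {φ : ℝ → E} (hφ : ∀ t ≥ (0 : ℝ), HasDerivAt φ (f (φ t)) t)
    (hbd : ∀ t ≥ (0 : ℝ), ‖φ t‖ ≤ C)
    (hCR : C + h * (T * (L ^ 2 * C) * Real.exp (L * T)) ≤ R) :
    ∀ j ≤ N, ‖(eulerStep f h)^[j] (φ 0) - φ (j * h)‖ ≤
      h * (T * (L ^ 2 * C) * Real.exp (L * T)) := by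
  have hC : 0 ≤ C := (norm_nonneg _).trans (hbd 0 le_rfl)
  have hT0 : 0 ≤ T := hT ▸ by positivity
  have hCR' : C ≤ R := le_trans (le_add_of_nonneg_right (by positivity)) hCR
  refine discrete_gronwall_of_continuation hh hL (by positivity) hT (by simp) fun j _ hj => ?_
  have ht : 0 ≤ j * h := by positivity
  have hm1 : φ (j * h) ∈ Metric.closedBall (0 : E) R := by simpa using (hbd _ ht).trans hCR'
  have hm2 : (eulerStep f h)^[j] (φ 0) ∈ Metric.closedBall (0 : E) R := by
    rw [mem_closedBall_zero_iff]
    have := norm_le_norm_add_norm_sub' ((eulerStep f h)^[j] (φ 0)) (φ (j * h))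
    linarith [hbd _ ht]
  have h1 := norm_eulerStep_sub_le hLip hh hm1 hm2
  have h2 := norm_solution_sub_eulerStep_le hL hLip hgrow hCR' hφ hbd ht hh
  rw [Function.iterate_succ_apply']
  have e : ((j + 1 : ℕ) : ℝ) * h = j * h + h := by push_cast; ring
  rw [e]
  rw [norm_sub_rev] at h2
  exact (norm_sub_le_norm_sub_add_norm_sub _ _ _).trans (add_le_add h1 h2)

/-- An exponentially stable `C²` vector field admits an Euler energy as a Lyapunov function. -/
theorem exists_eulerEnergy_lyapunov [FiniteDimensional ℝ E] {f : E → E} (hf : ContDiff ℝ 2 f)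
    (f0 : f 0 = 0) {μ δ r : ℝ} (hμ : 0 < μ) (hδ : 0 < δ) (hr : 0 < r)
    (hsol : ∀ x₀ : E, ‖x₀‖ ≤ r → ∃ φ : ℝ → E, φ 0 = x₀ ∧
      (∀ t ≥ (0 : ℝ), HasDerivAt φ (f (φ t)) t) ∧
      ∀ t ≥ (0 : ℝ), ‖φ t‖ ≤ μ * ‖x₀‖ * Real.exp (-δ * t)) :
    ∃ (h : ℝ) (N : ℕ) (a b c : ℝ), 0 < a ∧ 0 < b ∧ 0 < c ∧ ∀ x : E, ‖x‖ ≤ r →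
      a * ‖x‖ ^ 2 ≤ eulerEnergy f h N x ∧ eulerEnergy f h N x ≤ b * ‖x‖ ^ 2 ∧
      fderiv ℝ (eulerEnergy f h N) x (f x) ≤ -c * ‖x‖ ^ 2 := by
  set K := μ + 1 with hK
  set R := K * r with hR
  have hK0 : 0 < K := by positivity
  have hR0 : 0 < R := by positivity
  obtain ⟨L, M, hL, hM0, hD, hM⟩ := hf.exists_fderiv_bounds_closedBall R
  have hfd : Differentiable ℝ f := hf.differentiable two_ne_zero
  have hLip : ∀ x ∈ Metric.closedBall (0 : E) R, ∀ y ∈ Metric.closedBall (0 : E) R,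
      ‖f y - f x‖ ≤ L * ‖y - x‖ := fun x hx y hy =>
    (convex_closedBall _ _).norm_image_sub_le_of_norm_fderiv_le (fun z _ => hfd z) hD hx hy
  have hgrow : ∀ x ∈ Metric.closedBall (0 : E) R, ‖f x‖ ≤ L * ‖x‖ := fun x hx => by
    simpa [f0] using hLip 0 (by simpa using hR0.le) x hx
  obtain ⟨T, hT1, hTpos⟩ : ∃ T : ℝ, μ * Real.exp (-δ * T) ≤ 1 / 4 ∧ 0 < T := by
    have hlim : Filter.Tendsto (fun T : ℝ => μ * Real.exp (-δ * T)) Filter.atTop (nhds (μ * 0)) := by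
      refine Filter.Tendsto.const_mul _ (Real.tendsto_exp_atBot.comp ?_)
      exact Filter.tendsto_id.const_mul_atTop_of_neg (by linarith)
    rw [mul_zero] at hlim
    exact ((hlim.eventually (ge_mem_nhds (by norm_num : (0 : ℝ) < 1 / 4))).and
      (Filter.eventually_gt_atTop 0)).exists
  set A := 4 * (T * (L ^ 2 * μ) * Real.exp (L * T)) with hA
  set B := 8 * T * K * (T * (M * L ^ 2 * R * K) * Real.exp (L * T)) with hB
  have hA0 : 0 ≤ A := by positivity
  have hB0 : 0 ≤ B := by positivity
  obtain ⟨N, hN⟩ := exists_nat_gt (T * (A + B))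
  have hN0 : (0 : ℝ) < N := lt_of_le_of_lt (by positivity) hN
  set h := T / N with hh
  have hh0 : 0 < h := by positivity
  have hNh : N * h = T := by rw [hh]; field_simp
  have hAB : h * (A + B) ≤ 1 := by
    rw [hh, div_mul_eq_mul_div, div_le_one hN0]; exact hN.le
  have hhA : h * A ≤ 1 := by nlinarith
  have hhB : h * B ≤ 1 := by nlinarith
  refine ⟨h, N, h, T * K ^ 2, 1 / 2, hh0, by positivity, by norm_num, fun x hx => ?_⟩
  obtain ⟨φ, hφ0, hφ, hdecay⟩ := hsol x hx
  have hx0 := norm_nonneg x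
  have hbd : ∀ t ≥ (0 : ℝ), ‖φ t‖ ≤ μ * ‖x‖ := fun t ht =>
    (hdecay t ht).trans (mul_le_of_le_one_right (by positivity)
      (Real.exp_le_one_iff.2 (by nlinarith)))
  have herr : h * (T * (L ^ 2 * (μ * ‖x‖)) * Real.exp (L * T)) ≤ ‖x‖ / 4 := by
    calc _ = (h * A) * (‖x‖ / 4) := by rw [hA]; ring
      _ ≤ 1 * (‖x‖ / 4) := by gcongr
      _ = _ := one_mul _
  have hconv := norm_eulerStep_iterate_sub_le hL hh0.le hNh hLip hgrow hφ hbd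
    (by rw [hR, hK]; nlinarith)
  rw [hφ0] at hconv
  have horb : ∀ j ≤ N, ‖(eulerStep f h)^[j] x‖ ≤ K * ‖x‖ := by
    intro j hj
    have h1 := norm_le_norm_add_norm_sub' ((eulerStep f h)^[j] x) (φ (j * h))
    have h2 := hconv j hj
    have h3 := hbd (j * h) (by positivity)
    rw [hK]; linarith
  have hend : ‖(eulerStep f h)^[N] x‖ ≤ ‖x‖ / 2 := by
    have h1 := norm_le_norm_add_norm_sub' ((eulerStep f h)^[N] x) (φ (N * h))
    have h2 := hconv N le_rfl
    have h3 := hdecay (N * h) (by positivity)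
    rw [hNh] at h1 h2 h3
    nlinarith
  refine ⟨?_, ?_, ?_⟩
  · have hN1 : 0 ∈ Finset.range N := Finset.mem_range.2 (by exact_mod_cast hN0)
    exact Finset.single_le_sum (f := fun j => h * ‖(eulerStep f h)^[j] x‖ ^ 2)
      (fun j _ => by positivity) hN1
  · calc eulerEnergy f h N x ≤ ∑ j ∈ Finset.range N, h * (K * ‖x‖) ^ 2 := by
          refine Finset.sum_le_sum fun j hj => ?_
          gcongr
          exact horb j (Finset.mem_range.1 hj).le
      _ = N * h * K ^ 2 * ‖x‖ ^ 2 := by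
          rw [Finset.sum_const, Finset.card_range, nsmul_eq_mul]; ring
      _ = T * K ^ 2 * ‖x‖ ^ 2 := by rw [hNh]
  · exact fderiv_eulerEnergy_le hfd hL hM0 hK0.le hh0.le hNh hD hM hgrow
      (mul_le_mul_of_nonneg_left hx hK0.le) horb hend hhB

end

theorem enorm2_eq_norm_toLp (n : ℕ) (x : Fin n → ℝ) :
    enorm2 n x = ‖(WithLp.toLp 2 x : EuclideanSpace ℝ (Fin n))‖ := by
  simp [enorm2, sqnorm, EuclideanSpace.norm_eq]

theorem sqnorm_eq_norm_toLp_sq (n : ℕ) (x : Fin n → ℝ) :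
    sqnorm n x = ‖(WithLp.toLp 2 x : EuclideanSpace ℝ (Fin n))‖ ^ 2 := by
  simp [sqnorm, EuclideanSpace.norm_sq_eq]

/-- The polynomial vector field with components `P i`, on Euclidean space. -/
noncomputable def polyField {n : ℕ} (P : Fin n → MvPolynomial (Fin n) ℝ) (x : EuclideanSpace ℝ (Fin n)) :
    EuclideanSpace ℝ (Fin n) :=
  WithLp.toLp 2 fun i => MvPolynomial.eval x.ofLp (P i)

theorem contDiff_polyField {n : ℕ} (P : Fin n → MvPolynomial (Fin n) ℝ) :
    ContDiff ℝ 2 (polyField P) := by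
  refine contDiff_euclidean.2 fun i => ?_
  have h1 : ContDiff ℝ 2 fun x : Fin n → ℝ => MvPolynomial.eval x (P i) :=
    contDiffOn_univ.1 (AnalyticOnNhd.eval_mvPolynomial (P i)).contDiffOn_of_completeSpace
  exact h1.comp PiLp.contDiff_ofLp

/-- The components of the iterated Euler step of a polynomial vector field, as polynomials. -/
noncomputable def eulerPoly {n : ℕ} (P : Fin n → MvPolynomial (Fin n) ℝ) (h : ℝ) :
    ℕ → Fin n → MvPolynomial (Fin n) ℝ
  | 0 => MvPolynomial.X
  | j + 1 => fun i =>
      MvPolynomial.bind₁ (eulerPoly P h j) (MvPolynomial.X i + MvPolynomial.C h * P i)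

theorem eval_eulerPoly {n : ℕ} (P : Fin n → MvPolynomial (Fin n) ℝ) (h : ℝ) (j : ℕ) (i : Fin n)
    (x : Fin n → ℝ) :
    MvPolynomial.eval x (eulerPoly P h j i) =
      ((eulerStep (polyField P) h)^[j] (WithLp.toLp 2 x)) i := by
  induction j generalizing i with
  | zero => simp [eulerPoly]
  | succ j ih =>
    have e : (fun k => MvPolynomial.eval x (eulerPoly P h j k)) =
        ((eulerStep (polyField P) h)^[j] (WithLp.toLp 2 x)).ofLp := funext ih
    rw [Function.iterate_succ_apply', eulerPoly, MvPolynomial.eval, MvPolynomial.eval₂Hom_bind₁]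
    change MvPolynomial.eval (fun k => MvPolynomial.eval x (eulerPoly P h j k)) _ = _
    rw [e]
    simp [eulerStep, polyField]

theorem exists_eval_eq_eulerEnergy {n : ℕ} (P : Fin n → MvPolynomial (Fin n) ℝ) (h : ℝ) (N : ℕ) :
    ∃ v : MvPolynomial (Fin n) ℝ, ∀ x : Fin n → ℝ,
      MvPolynomial.eval x v = eulerEnergy (polyField P) h N (WithLp.toLp 2 x) := by
  refine ⟨∑ j ∈ Finset.range N, MvPolynomial.C h * ∑ i, eulerPoly P h j i ^ 2, fun x => ?_⟩
  simp [eulerEnergy, eval_eulerPoly, EuclideanSpace.norm_sq_eq]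

/-- The gradient made of slice derivatives represents the Fréchet derivative. -/
theorem sum_pd_mul_eq_fderiv {n : ℕ} {g : EuclideanSpace ℝ (Fin n) → ℝ} {x : Fin n → ℝ}
    (hg : DifferentiableAt ℝ g (WithLp.toLp 2 x)) (w : Fin n → ℝ) :
    ∑ i, pd n i (fun y => g (WithLp.toLp 2 y)) x * w i =
      fderiv ℝ g (WithLp.toLp 2 x) (WithLp.toLp 2 w) := by
  have hpd : ∀ i, pd n i (fun y => g (WithLp.toLp 2 y)) x =
      fderiv ℝ g (WithLp.toLp 2 x) (EuclideanSpace.single i 1) := by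
    intro i
    have h1 := hasDerivAt_update x i (x i)
    have h2 := ((PiLp.continuousLinearEquiv 2 ℝ
      (fun _ : Fin n => ℝ)).symm.toContinuousLinearMap.hasFDerivAt).comp_hasDerivAt (x i) h1
    refine (HasFDerivAt.comp_hasDerivAt_of_eq (x i) hg.hasFDerivAt h2 ?_).deriv
    simp
  have hw : (WithLp.toLp 2 w : EuclideanSpace ℝ (Fin n)) =
      ∑ i, w i • EuclideanSpace.single i (1 : ℝ) := by
    ext k
    simp [Finset.sum_apply, Pi.single_apply]
  rw [hw, map_sum]
  refine Finset.sum_congr rfl fun i _ => ?_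
  rw [hpd, map_smul, smul_eq_mul, mul_comm]

/-- consider `ẋ = f(x)` where `f` is a polynomial vector field
(each component `f_i(x) = eval x (P i)`) with `f(0) = 0`.  Suppose solutions
exist, are unique, and with constants `μ, δ, r > 0` every solution with
`‖x(0)‖₂ ≤ r` satisfies `‖x(t)‖₂ ≤ μ‖x(0)‖₂ e^{−δt}` for all `t ≥ 0`.  Then
there exist a polynomial `v : ℝⁿ → ℝ` and constants `α, β, γ > 0` such that
`α‖x‖₂² ≤ v(x) ≤ β‖x‖₂²` and `∇v(x)ᵀ f(x) ≤ −γ‖x‖₂²` for all `‖x‖₂ ≤ r`: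
exponentially stable polynomial ODEs admit polynomial Lyapunov functions. -/
theorem converse_lyapunov_poly_field (n : ℕ) (P : Fin n → MvPolynomial (Fin n) ℝ)
    (hP0 : ∀ i, MvPolynomial.eval (0 : Fin n → ℝ) (P i) = 0)
    (μ δ r : ℝ) (hμ : 0 < μ) (hδ : 0 < δ) (hr : 0 < r)
    (hex : ∀ x₀ : Fin n → ℝ, enorm2 n x₀ ≤ r →
      ∃ x : ℝ → (Fin n → ℝ), x 0 = x₀ ∧
        ∀ t ≥ (0:ℝ), HasDerivAt x (fun i => MvPolynomial.eval (x t) (P i)) t)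
    (huniq : ∀ x y : ℝ → (Fin n → ℝ),
      (∀ t ≥ (0:ℝ), HasDerivAt x (fun i => MvPolynomial.eval (x t) (P i)) t) →
      (∀ t ≥ (0:ℝ), HasDerivAt y (fun i => MvPolynomial.eval (y t) (P i)) t) →
      x 0 = y 0 → ∀ t ≥ (0:ℝ), x t = y t)
    (hstab : ∀ x : ℝ → (Fin n → ℝ),
      (∀ t ≥ (0:ℝ), HasDerivAt x (fun i => MvPolynomial.eval (x t) (P i)) t) →
      enorm2 n (x 0) ≤ r →
      ∀ t ≥ (0:ℝ), enorm2 n (x t) ≤ μ * enorm2 n (x 0) * Real.exp (-δ * t)) :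
    ∃ (v : MvPolynomial (Fin n) ℝ) (a b c : ℝ), 0 < a ∧ 0 < b ∧ 0 < c ∧
      ∀ x : Fin n → ℝ, enorm2 n x ≤ r →
        a * sqnorm n x ≤ MvPolynomial.eval x v ∧
        MvPolynomial.eval x v ≤ b * sqnorm n x ∧
        ∑ i, pd n i (fun y => MvPolynomial.eval y v) x *
            MvPolynomial.eval x (P i) ≤ -c * sqnorm n x := by
  have f0 : polyField P 0 = 0 := by
    ext i
    exact hP0 i
  have hsol : ∀ x₀ : EuclideanSpace ℝ (Fin n), ‖x₀‖ ≤ r → ∃ φ : ℝ → EuclideanSpace ℝ (Fin n),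
      φ 0 = x₀ ∧ (∀ t ≥ (0 : ℝ), HasDerivAt φ (polyField P (φ t)) t) ∧
      ∀ t ≥ (0 : ℝ), ‖φ t‖ ≤ μ * ‖x₀‖ * Real.exp (-δ * t) := by
    intro x₀ hx₀
    have hx₀' : enorm2 n x₀.ofLp ≤ r := by rwa [enorm2_eq_norm_toLp]
    obtain ⟨x, hx0, hx⟩ := hex x₀.ofLp hx₀'
    refine ⟨fun t => WithLp.toLp 2 (x t), by simp [hx0], fun t ht => ?_, fun t ht => ?_⟩
    · exact ((PiLp.continuousLinearEquiv 2 ℝ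
        (fun _ : Fin n => ℝ)).symm.toContinuousLinearMap.hasFDerivAt).comp_hasDerivAt t (hx t ht)
    · have := hstab x hx (hx0 ▸ hx₀') t ht
      simpa [enorm2_eq_norm_toLp, hx0] using this
  obtain ⟨h, N, a, b, c, ha, hb, hc, hV⟩ :=
    exists_eulerEnergy_lyapunov (contDiff_polyField P) f0 hμ hδ hr hsol
  obtain ⟨v, hv⟩ := exists_eval_eq_eulerEnergy P h N
  refine ⟨v, a, b, c, ha, hb, hc, fun x hx => ?_⟩
  rw [enorm2_eq_norm_toLp] at hx
  obtain ⟨h1, h2, h3⟩ := hV _ hx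
  have hdiff : DifferentiableAt ℝ (eulerEnergy (polyField P) h N) (WithLp.toLp 2 x) :=
    (hasFDerivAt_eulerEnergy ((contDiff_polyField P).differentiable two_ne_zero) h N
      _).differentiableAt
  rw [sqnorm_eq_norm_toLp_sq, hv]
  refine ⟨h1, h2, ?_⟩
  simp only [hv]
  rw [sum_pd_mul_eq_fderiv hdiff]
  exact h3
end
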